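/- arXiv:1305.5121 — 2 statements merged into one kernel-verified Lean document; each statement's English description precedes it below -/
import Mathlib

section
/- Let F be a finite field, L a finite field extension of F of degree n ≥ 2, and a ∈ L \ F. The nonassociative cyclic algebra A = (L/F, σ, a) is a division algebra (equivalently, a finite semifield) if and only if a belongs to no proper subfield of L containing F, i.e. if and only if F(a) = L. -/
noncomputable section

/-- Multiplication of the nonassociative cyclic algebra `(L/F, σ, a)` of degree `n`. -/
def cycMul {F L : Type*} [Field F] [Field L] [Algebra F L] (n : ℕ)
    (σ : L ≃ₐ[F] L) (a : L) (x y : Fin n → L) : Fin n → L :=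
  fun k => ∑ i : Fin n, ∑ j : Fin n,
    if (i : ℕ) + (j : ℕ) = (k : ℕ) then x i * (σ ^ (i : ℕ)) (y j)
    else if (i : ℕ) + (j : ℕ) = (k : ℕ) + n then x i * (σ ^ (i : ℕ)) (y j) * a
    else 0

/-- Right multiplication by `z ^ j` in the nonassociative cyclic algebra, for `j ≤ n`. -/
def cycShift {L : Type*} [Field L] (n : ℕ) (a : L) (j : ℕ) (x : Fin n → L) : Fin n → L :=
  fun k => if h : j ≤ k then x ⟨k - j, by omega⟩ else x ⟨k + n - j, by omega⟩ * a

/-- Right multiplication by the scalar `l` in the nonassociative cyclic algebra. -/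
def cycTwist {F L : Type*} [Field F] [Field L] [Algebra F L] (n : ℕ)
    (σ : L ≃ₐ[F] L) (l : L) (x : Fin n → L) : Fin n → L :=
  fun k => x k * (σ ^ (k : ℕ)) l

section

variable {F L : Type*} [Field F] [Field L] [Algebra F L] {n : ℕ} {σ : L ≃ₐ[F] L} {a : L}

theorem cycShift_zero (x : Fin n → L) : cycShift n a 0 x = x := by
  ext k
  simp [cycShift]

theorem cycShift_self (x : Fin n → L) : cycShift n a n x = a • x := by
  ext k
  have : ¬ n ≤ (k : ℕ) := by omega
  simp [cycShift, this, mul_comm]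

theorem cycShift_succ {j : ℕ} (hj : j < n) (x : Fin n → L) :
    cycShift n a (j + 1) x = cycShift n a 1 (cycShift n a j x) := by
  ext k
  have hk := k.2
  by_cases h1 : 1 ≤ (k : ℕ)
  · by_cases h2 : j + 1 ≤ (k : ℕ)
    · have h3 : j ≤ (k : ℕ) - 1 := by omega
      simp only [cycShift, h1, h2, h3, dite_true]
      congr 2
      omega
    · have h3 : ¬ j ≤ (k : ℕ) - 1 := by omega
      simp only [cycShift, h1, h2, h3, dite_true, dite_false]
      congr 3
      omega
  · have h2 : ¬ j + 1 ≤ (k : ℕ) := by omega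
    have h3 : j ≤ (k : ℕ) + n - 1 := by omega
    simp only [cycShift, h1, h2, h3, dite_true, dite_false]
    congr 3
    omega

theorem cycShift_single_mem {W : Submodule F (Fin n → L)} (ha : a ≠ 0)
    (hshift : ∀ j ≤ n, ∀ w ∈ W, cycShift n a j w ∈ W) {i : Fin n}
    (hi : ∀ c : L, Pi.single i c ∈ W) (k : Fin n) (c : L) : Pi.single k c ∈ W := by
  have hik := i.2
  have hk := k.2
  by_cases h : i ≤ k
  · have h' : (i : ℕ) ≤ k := h
    convert hshift (k - i) (by omega) _ (hi c) using 1
    ext m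
    have hm := m.2
    simp only [cycShift, Pi.single_apply, Fin.ext_iff]
    grind
  · have h' : ¬ (i : ℕ) ≤ k := h
    convert hshift (k + n - i) (by omega) _ (hi (c * a⁻¹)) using 1
    ext m
    have hm := m.2
    simp only [cycShift, Pi.single_apply, Fin.ext_iff]
    grind

theorem pow_apply_injOn_of_adjoin_eq_top (hord : orderOf σ = n)
    (htop : Algebra.adjoin F {a} = ⊤) :
    Function.Injective fun i : Fin n => (σ ^ (i : ℕ)) a := by
  intro i j hij
  have h : ((σ ^ (i : ℕ) : L ≃ₐ[F] L) : L →ₐ[F] L) = ((σ ^ (j : ℕ) : L ≃ₐ[F] L) : L →ₐ[F] L) :=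
    AlgHom.ext_of_adjoin_eq_top htop (by simpa [Set.EqOn] using hij)
  have h' : σ ^ (i : ℕ) = σ ^ (j : ℕ) := AlgEquiv.ext fun x => DFunLike.congr_fun h x
  exact Fin.ext (pow_injOn_Iio_orderOf (x := σ) (by simp [hord]) (by simp [hord]) h')

/-- If `F[a] = L`, the cyclic algebra has no proper nonzero subspace that is stable under right
multiplication by `z` and by scalars. -/
theorem eq_top_of_cycShift_mem_of_cycTwist_mem (hord : orderOf σ = n) (ha : a ≠ 0)
    (htop : Algebra.adjoin F {a} = ⊤) {W : Submodule F (Fin n → L)}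
    (hshift : ∀ w ∈ W, cycShift n a 1 w ∈ W) (htwist : ∀ l, ∀ w ∈ W, cycTwist n σ l w ∈ W)
    {x : Fin n → L} (hx : x ∈ W) (hx0 : x ≠ 0) : W = ⊤ := by
  have hshift' : ∀ j ≤ n, ∀ w ∈ W, cycShift n a j w ∈ W := by
    intro j
    induction j with
    | zero => intro _ w hw; rwa [cycShift_zero]
    | succ j ih =>
      intro hj w hw
      rw [cycShift_succ (by omega)]
      exact hshift _ (ih (by omega) w hw)
  have hsmul : ∀ c : L, ∀ w ∈ W, c • w ∈ W := by
    intro c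
    have hc : c ∈ Algebra.adjoin F {a} := htop ▸ Algebra.mem_top
    induction hc using Algebra.adjoin_induction with
    | mem c hc =>
      intro w hw
      rw [Set.mem_singleton_iff.1 hc, ← cycShift_self]
      exact hshift' n le_rfl w hw
    | algebraMap r =>
      intro w hw
      rw [algebraMap_smul]
      exact W.smul_mem r hw
    | add b c _ _ hb hc =>
      intro w hw
      rw [add_smul]
      exact W.add_mem (hb w hw) (hc w hw)
    | mul b c _ _ hb hc =>
      intro w hw
      rw [mul_smul]
      exact hb _ (hc w hw)
  have heval : ∀ p : Polynomial L, ∀ w ∈ W,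
      (fun i : Fin n => p.eval ((σ ^ (i : ℕ)) a) * w i) ∈ W := by
    intro p
    induction p using Polynomial.induction_on' with
    | add p q hp hq =>
      intro w hw
      convert W.add_mem (hp w hw) (hq w hw) using 1
      ext i
      simp [add_mul]
    | monomial m c =>
      induction m with
      | zero =>
        intro w hw
        convert hsmul c w hw using 1
        ext i
        simp
      | succ m ih =>
        intro w hw
        convert ih _ (htwist a w hw) using 1
        ext i
        simp only [Polynomial.eval_monomial, cycTwist]
        ring
  obtain ⟨i, hi⟩ := Function.ne_iff.1 hx0
  have hinj := pow_apply_injOn_of_adjoin_eq_top hord htop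
  have hsingle : ∀ c : L, Pi.single i c ∈ W := by
    intro c
    have h := hsmul (c * (x i)⁻¹) _
      (heval (Lagrange.basis Finset.univ (fun i : Fin n => (σ ^ (i : ℕ)) a) i) x hx)
    convert h using 1
    ext k
    by_cases hk : k = i
    · subst hk
      have := Lagrange.eval_basis_self (s := Finset.univ)
        (v := fun i : Fin n => (σ ^ (i : ℕ)) a) hinj.injOn (Finset.mem_univ k)
      simp only [Pi.zero_apply] at hi
      simp only [Pi.smul_apply, this, smul_eq_mul, Pi.single_eq_same]
      field_simp
    · have h0 := Lagrange.eval_basis_of_ne (s := Finset.univ)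
        (v := fun i : Fin n => (σ ^ (i : ℕ)) a) (Ne.symm hk) (Finset.mem_univ k)
      simp only [Pi.smul_apply, h0, zero_mul, smul_zero, Pi.single_apply, if_neg hk]
  refine eq_top_iff.2 fun w _ => ?_
  rw [← Finset.univ_sum_single w]
  exact W.sum_mem fun k _ => cycShift_single_mem ha hshift' hsingle k (w k)

theorem cycMul_apply (x y : Fin n → L) (k : Fin n) :
    cycMul n σ a x y k = ∑ j : Fin n, if h : (j : ℕ) ≤ k
      then x ⟨k - j, by omega⟩ * (σ ^ ((k : ℕ) - j)) (y j)
      else x ⟨k + n - j, by omega⟩ * (σ ^ ((k : ℕ) + n - j)) (y j) * a := by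
  rw [cycMul, Finset.sum_comm]
  refine Finset.sum_congr rfl fun j _ => ?_
  have hj := j.2
  have hk := k.2
  split_ifs with h
  · rw [Finset.sum_eq_single ⟨k - j, by omega⟩]
    · rw [if_pos (by simp only; omega)]
    · intro i _ hi
      have hi' : (i : ℕ) ≠ k - j := fun h => hi (Fin.ext h)
      have := i.2
      rw [if_neg (by omega), if_neg (by omega)]
    · simp
  · rw [Finset.sum_eq_single ⟨k + n - j, by omega⟩]
    · rw [if_neg (by simp only; omega), if_pos (by simp only; omega)]
    · intro i _ hi
      have hi' : (i : ℕ) ≠ k + n - j := fun h => hi (Fin.ext h)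
      have := i.2
      rw [if_neg (by omega), if_neg (by omega)]
    · simp

theorem cycMul_eq_sum (hord : orderOf σ = n) (x y : Fin n → L) :
    cycMul n σ a x y =
      ∑ j : Fin n, cycTwist n σ ((σ ^ (j : ℕ)).symm (y j)) (cycShift n a j x) := by
  have hcomp : ∀ (i j m : ℕ), i + j = m ∨ i + j = m + n →
      ∀ l : L, (σ ^ i) l = (σ ^ m) ((σ ^ j).symm l) := by
    intro i j m h l
    have hpow : σ ^ (i + j) = σ ^ m := by
      rcases h with h | h
      · rw [h]
      · rw [h, pow_add, ← hord, pow_orderOf_eq_one, mul_one]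
    rw [← hpow, pow_add, AlgEquiv.mul_apply, AlgEquiv.apply_symm_apply]
  ext k
  rw [cycMul_apply, Finset.sum_apply]
  refine Finset.sum_congr rfl fun j _ => ?_
  have hj := j.2
  simp only [cycTwist, cycShift]
  split_ifs with h
  · rw [hcomp (k - j) j k (by omega)]
  · rw [hcomp (k + n - j) j k (by omega)]
    ring

/-- The linear map `(l_j) ↦ ∑_{j < d} x z ^ j l_j`. -/
def cycSpan (n : ℕ) (σ : L ≃ₐ[F] L) (a : L) (d : ℕ) (x : Fin n → L) :
    (Fin d → L) →ₗ[F] (Fin n → L) where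
  toFun l := ∑ j : Fin d, cycTwist n σ (l j) (cycShift n a j x)
  map_add' l m := by
    ext k
    simp [cycTwist, mul_add, Finset.sum_add_distrib]
  map_smul' r l := by
    ext k
    simp [cycTwist, Finset.smul_sum]

theorem cycTwist_cycTwist (l m : L) (x : Fin n → L) :
    cycTwist n σ l (cycTwist n σ m x) = cycTwist n σ (m * l) x := by
  ext k
  simp [cycTwist, mul_assoc]

theorem cycTwist_one (x : Fin n → L) : cycTwist n σ 1 x = x := by
  ext k
  simp [cycTwist]

theorem cycTwist_sum {ι : Type*} (s : Finset ι) (l : L) (f : ι → Fin n → L) :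
    cycTwist n σ l (∑ i ∈ s, f i) = ∑ i ∈ s, cycTwist n σ l (f i) := by
  ext k
  simp [cycTwist, Finset.sum_mul]

theorem cycShift_sum {ι : Type*} (s : Finset ι) (j : ℕ) (f : ι → Fin n → L) :
    cycShift n a j (∑ i ∈ s, f i) = ∑ i ∈ s, cycShift n a j (f i) := by
  ext k
  simp only [cycShift, Finset.sum_apply]
  split_ifs
  · rfl
  · rw [Finset.sum_mul]

theorem cycShift_one_cycTwist (hord : orderOf σ = n) (l : L) (x : Fin n → L) :
    cycShift n a 1 (cycTwist n σ l x) = cycTwist n σ (σ.symm l) (cycShift n a 1 x) := by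
  have hsymm : ∀ i : ℕ, (σ ^ (i + 1)) (σ.symm l) = (σ ^ i) l := by
    intro i
    rw [pow_succ, AlgEquiv.mul_apply, AlgEquiv.apply_symm_apply]
  ext k
  have hk := k.2
  simp only [cycShift, cycTwist]
  split_ifs with h
  · rw [← hsymm, Nat.sub_add_cancel h]
  · have hpow : σ ^ ((k : ℕ) + n) = σ ^ (k : ℕ) := by
      rw [pow_add, orderOf_dvd_iff_pow_eq_one.1 hord.dvd, mul_one]
    rw [← hsymm, Nat.sub_add_cancel (by omega), hpow]
    ring

theorem cycMul_ne_zero_of_adjoin_eq_top [FiniteDimensional F L] (hn : Module.finrank F L = n)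
    (hord : orderOf σ = n) (ha : a ≠ 0) (htop : Algebra.adjoin F {a} = ⊤) {x y : Fin n → L}
    (hx : x ≠ 0) (hy : y ≠ 0) : cycMul n σ a x y ≠ 0 := by
  intro hxy
  obtain ⟨d, hd, hmax⟩ : ∃ d, y d ≠ 0 ∧ ∀ j, d < j → y j = 0 := by
    obtain ⟨i, hi⟩ := Function.ne_iff.1 hy
    obtain ⟨d, hd, hm⟩ := (Set.toFinite {i : Fin n | y i ≠ 0}).exists_maximal ⟨i, hi⟩
    refine ⟨d, hd, fun j hj => ?_⟩
    by_contra h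
    exact absurd (hm h hj.le) (not_le.2 hj)
  set W := LinearMap.range (cycSpan n σ a d x) with hW
  have hlt : ∀ j < (d : ℕ), ∀ l, cycTwist n σ l (cycShift n a j x) ∈ W := by
    intro j hj l
    refine ⟨Pi.single ⟨j, hj⟩ l, ?_⟩
    simp only [cycSpan, LinearMap.coe_mk, AddHom.coe_mk]
    rw [Finset.sum_eq_single ⟨j, hj⟩]
    · simp
    · intro i _ hi
      ext k
      simp [hi, cycTwist]
    · simp
  have htwist : ∀ l, ∀ w ∈ W, cycTwist n σ l w ∈ W := by
    rintro l _ ⟨m, rfl⟩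
    simp only [cycSpan, LinearMap.coe_mk, AddHom.coe_mk]
    rw [cycTwist_sum]
    refine W.sum_mem fun j _ => ?_
    rw [cycTwist_cycTwist]
    exact hlt j j.2 _
  have hdmem : cycShift n a d x ∈ W := by
    rw [cycMul_eq_sum hord, ← Finset.add_sum_erase _ _ (Finset.mem_univ d)] at hxy
    have hmem : cycTwist n σ ((σ ^ (d : ℕ)).symm (y d)) (cycShift n a d x) ∈ W := by
      rw [eq_neg_of_add_eq_zero_left hxy]
      refine W.neg_mem (W.sum_mem fun j hj => ?_)
      rcases lt_or_gt_of_ne (Finset.ne_of_mem_erase hj) with h | h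
      · exact hlt j h _
      · convert W.zero_mem
        ext k
        simp [hmax j h, cycTwist]
    have h0 : (σ ^ (d : ℕ)).symm (y d) ≠ 0 := by simpa using hd
    have := htwist ((σ ^ (d : ℕ)).symm (y d))⁻¹ _ hmem
    rwa [cycTwist_cycTwist, mul_inv_cancel₀ h0, cycTwist_one] at this
  have hle : ∀ j ≤ (d : ℕ), ∀ l, cycTwist n σ l (cycShift n a j x) ∈ W := by
    intro j hj l
    rcases hj.lt_or_eq with h | rfl
    · exact hlt j h l
    · exact htwist l _ hdmem
  have hshift : ∀ w ∈ W, cycShift n a 1 w ∈ W := by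
    rintro _ ⟨m, rfl⟩
    simp only [cycSpan, LinearMap.coe_mk, AddHom.coe_mk]
    rw [cycShift_sum]
    refine W.sum_mem fun j _ => ?_
    rw [cycShift_one_cycTwist hord, ← cycShift_succ (by omega)]
    exact hle _ j.2 _
  have hxW : x ∈ W := by
    simpa only [cycTwist_one, cycShift_zero] using hle 0 (Nat.zero_le _) 1
  have hWtop := eq_top_of_cycShift_mem_of_cycTwist_mem hord ha htop hshift htwist hxW hx
  have hcard := LinearMap.finrank_le_finrank_of_surjective (LinearMap.range_eq_top.1 hWtop)
  simp only [Module.finrank_pi_fintype, hn, Finset.sum_const, Finset.card_univ,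
    Fintype.card_fin, smul_eq_mul] at hcard
  have := d.2
  exact absurd (Nat.le_of_mul_le_mul_right hcard (by omega)) (by omega)

theorem exists_prod_pow_apply_eq [Finite L] [IsGalois F L] (hn : Module.finrank F L = n)
    (hord : orderOf σ = n) (K : IntermediateField F L) (haK : a ∈ K) :
    ∃ c : L, ∏ j ∈ Finset.range (Module.finrank K L),
      (σ ^ (Module.finrank F K * j)) c = a := by
  have : Finite F := Finite.of_injective _ (algebraMap F L).injective
  have : Finite K := Finite.of_injective _ (algebraMap K L).injective
  have hmul : Module.finrank F K * Module.finrank K L = n := by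
    rw [Module.finrank_mul_finrank, hn]
  have hfix : σ ^ Module.finrank F K ∈ K.fixingSubgroup := by
    rw [IntermediateField.mem_fixingSubgroup_iff]
    intro x hx
    have h := AlgEquiv.restrictNormal_commutes (σ ^ Module.finrank F K) K ⟨x, hx⟩
    have h1 : (σ ^ Module.finrank F K).restrictNormal K = 1 := by
      change AlgEquiv.restrictNormalHom K (σ ^ Module.finrank F K) = 1
      rw [map_pow, ← IsGalois.card_aut_eq_finrank, pow_card_eq_one']
    rw [h1] at h
    exact h.symm
  obtain ⟨c, hc⟩ := FiniteField.norm_surjective K L ⟨a, haK⟩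
  refine ⟨c, ?_⟩
  have hnorm := Algebra.norm_eq_prod_automorphisms K c
  rw [hc] at hnorm
  let τ : L ≃ₐ[K] L := K.fixingSubgroupEquiv ⟨_, hfix⟩
  have hτ : ∀ (j : ℕ) (x : L), (τ ^ j) x = (σ ^ (Module.finrank F K * j)) x := by
    intro j x
    rw [pow_mul, ← map_pow]
    rfl
  have hbij : Function.Bijective fun j : Fin (Module.finrank K L) => τ ^ (j : ℕ) := by
    rw [Fintype.bijective_iff_injective_and_card]
    refine ⟨fun i j hij => ?_, ?_⟩
    · have h : σ ^ (Module.finrank F K * (i : ℕ)) = σ ^ (Module.finrank F K * (j : ℕ)) := by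
        ext x
        rw [← hτ, ← hτ]
        exact DFunLike.congr_fun hij x
      have hpos : 0 < Module.finrank F K := Module.finrank_pos
      have hlt : ∀ i : Fin (Module.finrank K L),
          Module.finrank F K * (i : ℕ) ∈ Set.Iio (orderOf σ) := fun i => by
        rw [hord, Set.mem_Iio, ← hmul]
        exact Nat.mul_lt_mul_of_pos_left i.2 hpos
      exact Fin.ext (Nat.eq_of_mul_eq_mul_left hpos (pow_injOn_Iio_orderOf (hlt i) (hlt j) h))
    · rw [Fintype.card_fin, ← IsGalois.card_aut_eq_finrank, Nat.card_eq_fintype_card]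
  rw [Finset.prod_range]
  simp only [← hτ]
  rw [hbij.prod_comp fun g : L ≃ₐ[K] L => g c]
  exact hnorm.symm

theorem exists_cycMul_eq_zero {m d : ℕ} (hmd : m * d = n) (hm : 0 < m) (hd : 1 < d)
    (ha : a ≠ 0) {c : L} (hc : ∏ j ∈ Finset.range d, (σ ^ (m * j)) c = a) :
    ∃ x y : Fin n → L, x ≠ 0 ∧ y ≠ 0 ∧ cycMul n σ a x y = 0 := by
  have hmn : m < n := by nlinarith
  have hc0 : c ≠ 0 := by
    rintro rfl
    refine ha (hc ▸ Finset.prod_eq_zero (Finset.mem_range.2 (by omega : 0 < d)) ?_)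
    simp
  let X : ℕ → L := fun i => ∏ j ∈ Finset.range i, ((σ ^ (m * (j + 1))) c)⁻¹
  have hX : ∀ i, X (i + 1) * (σ ^ (m * (i + 1))) c = X i := by
    intro i
    simp only [X, Finset.prod_range_succ]
    rw [inv_mul_cancel_right₀ ((map_ne_zero _).2 hc0)]
  have hXd : X (d - 1) * a = c := by
    obtain ⟨e, rfl⟩ : ∃ e, d = e + 1 := ⟨d - 1, by omega⟩
    rw [← hc, Finset.prod_range_succ']
    simp only [X, add_tsub_cancel_right, Finset.prod_inv_distrib, mul_zero, pow_zero,
      AlgEquiv.one_apply]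
    rw [inv_mul_cancel_left₀]
    exact Finset.prod_ne_zero_iff.2 fun j _ => (map_ne_zero _).2 hc0
  let x : Fin n → L := fun k => if m ∣ (k : ℕ) then X (k / m) else 0
  let o : Fin n := ⟨0, by omega⟩
  let t : Fin n := ⟨m, hmn⟩
  have hot : o ≠ t := fun h => hm.ne (Fin.ext_iff.1 h)
  let y : Fin n → L := Pi.single t 1 - Pi.single o c
  have hyt : y t = 1 := by simp [y, hot.symm]
  have hyo : y o = -c := by simp [y, hot]
  refine ⟨x, y, fun h => ?_, fun h => ?_, ?_⟩
  · have := congrFun h o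
    simp [x, o, X] at this
  · simp [h] at hyt
  · ext k
    have hk := k.2
    rw [cycMul_apply, Finset.sum_eq_add_of_mem o t (Finset.mem_univ _) (Finset.mem_univ _) hot]
    · rw [hyt, hyo]
      simp only [o, t, x, zero_le, dite_true, Nat.sub_zero, map_neg, map_one, Pi.zero_apply]
      by_cases hdvd : m ∣ (k : ℕ)
      · obtain ⟨i, hi⟩ := hdvd
        rcases i with _ | i
        · have h1 : (k : ℕ) = 0 := by simpa using hi
          have h2 : 0 + n - m = m * (d - 1) := by rw [← hmd, Nat.mul_sub]; simp
          have h3 : ¬ m ≤ 0 := by omega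
          simp only [h1, h2, h3, dite_false, dvd_mul_right, if_true, Nat.mul_div_cancel_left _ hm,
            dvd_zero, Nat.zero_div, pow_zero, AlgEquiv.one_apply, mul_one, hXd]
          simp [X]
        · have h2 : m * (i + 1) - m = m * i := by rw [mul_add, mul_one, Nat.add_sub_cancel]
          have h3 : m ≤ m * (i + 1) := Nat.le_mul_of_pos_right _ (by omega)
          simp only [hi, h2, h3, dite_true, dvd_mul_right, if_true, Nat.mul_div_cancel_left _ hm,
            mul_one, ← hX i]
          ring
      · have h1 : m ≤ (k : ℕ) → ¬ m ∣ (k : ℕ) - m := fun h h' =>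
          hdvd (Nat.sub_add_cancel h ▸ dvd_add h' dvd_rfl)
        have h2 : ¬ m ∣ (k : ℕ) + n - m := fun h' => by
          have h4 : (k : ℕ) + n = (k + n - m) + m := by omega
          refine hdvd ((Nat.dvd_add_left (hmd ▸ dvd_mul_right m d : m ∣ n)).1 ?_)
          rw [h4]
          exact dvd_add h' dvd_rfl
        rw [if_neg hdvd, if_neg h2]
        split_ifs with h h'
        · exact absurd h' (h1 h)
        · ring
        · ring
    · intro j _ hj
      have : y j = 0 := by simp [y, hj.1, hj.2]
      simp [this]

end

/-- over a finite field `F` with extension `L/F` of degree `n ≥ 2`,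
the nonassociative cyclic algebra `(L/F, σ, a)` is a division algebra (a finite semifield)
if and only if `a` belongs to no proper subfield of `L` containing `F`, i.e. `F(a) = L`. -/
theorem sandler_division_iff_generates
    {F L : Type*} [Field F] [Fintype F] [Field L] [Algebra F L] [IsGalois F L]
    (n : ℕ) (hn : 2 ≤ n) (hrank : Module.finrank F L = n)
    (σ : L ≃ₐ[F] L) (hσ : ∀ τ : L ≃ₐ[F] L, τ ∈ Subgroup.zpowers σ)
    (a : L) (ha : a ∉ Set.range (algebraMap F L)) :
    (∀ x y : Fin n → L, cycMul n σ a x y = 0 → x = 0 ∨ y = 0) ↔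
      IntermediateField.adjoin F {a} = ⊤ := by
  have : FiniteDimensional F L := FiniteDimensional.of_finrank_pos (by omega)
  have : Finite L := Module.finite_of_finite F
  have ha0 : a ≠ 0 := by
    rintro rfl
    exact ha ⟨0, map_zero _⟩
  have hord : orderOf σ = n := by
    rw [orderOf_eq_card_of_forall_mem_zpowers hσ, IsGalois.card_aut_eq_finrank, hrank]
  constructor
  · intro h
    by_contra hne
    set K := IntermediateField.adjoin F {a}
    obtain ⟨c, hc⟩ := exists_prod_pow_apply_eq hrank hord K
      (IntermediateField.mem_adjoin_simple_self F a)
    have hd1 : Module.finrank K L ≠ 1 := fun h1 =>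
      hne (IntermediateField.finrank_eq_one_iff_eq_top.1 h1)
    have hd0 : 0 < Module.finrank K L := Module.finrank_pos
    obtain ⟨x, y, hx, hy, hxy⟩ := exists_cycMul_eq_zero
      ((Module.finrank_mul_finrank F K L).trans hrank) Module.finrank_pos (by omega) ha0 hc
    exact (h x y hxy).elim hx hy
  · intro htop x y hxy
    by_contra! hne
    have htop' : Algebra.adjoin F {a} = ⊤ := by
      rw [← IntermediateField.adjoin_simple_toSubalgebra_of_isAlgebraic
        (Algebra.IsAlgebraic.isAlgebraic a), htop, IntermediateField.top_toSubalgebra]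
    exact cycMul_ne_zero_of_adjoin_eq_top hrank hord ha0 htop' hne.1 hne.2 hxy
end
end

section
/- Let F = 𝔽_q with q a prime power and let L be the field extension of F of prime degree r, where r divides q−1, so that L = F[T]/(T^r − c) for some c ∈ F^×, with Gal(L/F) generated by σ. If a ∈ L \ F is not of the form k T^j for any k ∈ F^× and 1 ≤ j ≤ r−1, then the group of F-algebra automorphisms of (L/F, σ, a) is isomorphic to the cyclic group ℤ/sℤ with s = (q^r − 1)/(q − 1). If a = k T^j for some k ∈ F^× and 1 ≤ j ≤ r−1, then the group of F-algebra automorphisms of (L/F, σ, a) has order r · (q^r − 1)/(q − 1). -/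
noncomputable section

/-- The unit element `1 = z^0` of `(L/F, σ, a)`. -/
def cycOne (L : Type*) [Field L] (n : ℕ) : Fin n → L :=
  fun k => if (k : ℕ) = 0 then 1 else 0


/-- The automorphism group (as a subgroup of the group of `F`-linear self-equivalences)
of a not-necessarily-associative algebra given by a multiplication `mul` and unit `one`
on an `F`-vector space `M`. -/
def ntAut (F M : Type*) [Field F] [AddCommGroup M] [Module F M]
    (mul : M → M → M) (one : M) : Subgroup (M ≃ₗ[F] M) where
  carrier := {e | (∀ x y : M, e (mul x y) = mul (e x) (e y)) ∧ e one = one}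
  one_mem' := ⟨fun _ _ => rfl, rfl⟩
  mul_mem' := by
    rintro e f ⟨he, he1⟩ ⟨hf, hf1⟩
    refine ⟨fun x y => ?_, ?_⟩
    · show e (f (mul x y)) = mul (e (f x)) (e (f y))
      rw [hf, he]
    · show e (f one) = one
      rw [hf1, he1]
  inv_mem' := by
    rintro e ⟨he, he1⟩
    refine ⟨fun x y => ?_, ?_⟩
    · apply e.injective
      show e (e.symm (mul x y)) = e (mul (e.symm x) (e.symm y))
      rw [e.apply_symm_apply, he, e.apply_symm_apply, e.apply_symm_apply]
    · apply e.injective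
      show e (e.symm one) = e one
      rw [e.apply_symm_apply, he1]

section CyclicAlgebra

variable {F L : Type*} [Field F] [Field L] [Algebra F L]

/-- The partial norm `k σ(k) ⋯ σ^{i-1}(k)`. -/
def partialNorm (σ : L ≃ₐ[F] L) (k : L) (i : ℕ) : L :=
  ∏ j ∈ Finset.range i, (σ ^ j) k

@[simp] lemma partialNorm_zero (σ : L ≃ₐ[F] L) (k : L) : partialNorm σ k 0 = 1 := by
  simp [partialNorm]

@[simp] lemma partialNorm_one (σ : L ≃ₐ[F] L) (k : L) : partialNorm σ k 1 = k := by
  simp [partialNorm]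

lemma partialNorm_add (σ : L ≃ₐ[F] L) (k : L) (i j : ℕ) :
    partialNorm σ k (i + j) = partialNorm σ k i * (σ ^ i) (partialNorm σ k j) := by
  simp [partialNorm, Finset.prod_range_add, pow_add, -AlgEquiv.coe_pow]

lemma partialNorm_ne_zero (σ : L ≃ₐ[F] L) {k : L} (hk : k ≠ 0) (i : ℕ) :
    partialNorm σ k i ≠ 0 := by
  simp [partialNorm, Finset.prod_ne_zero_iff, hk, -AlgEquiv.coe_pow]

lemma partialNorm_mul (σ : L ≃ₐ[F] L) (k l : L) (i : ℕ) :
    partialNorm σ (k * l) i = partialNorm σ k i * partialNorm σ l i := by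
  simp [partialNorm, Finset.prod_mul_distrib]

/-- The element `x z^i` of the nonassociative cyclic algebra. -/
def cycMonomial (n i : ℕ) (x : L) : Fin n → L :=
  fun k => if (k : ℕ) = i then x else 0

lemma cycMonomial_smul (n i : ℕ) (f : F) (x : L) :
    cycMonomial n i (f • x) = f • cycMonomial n i x := by
  ext k; simp [cycMonomial]

lemma cycMonomial_add (n i : ℕ) (x y : L) :
    cycMonomial n i (x + y) = cycMonomial n i x + cycMonomial n i y := by
  ext k; simp only [cycMonomial, Pi.add_apply]; split_ifs <;> simp

lemma sum_cycMonomial (n : ℕ) (x : Fin n → L) :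
    ∑ i : Fin n, cycMonomial n i (x i) = x := by
  ext k
  simp only [Finset.sum_apply, cycMonomial]
  rw [Finset.sum_eq_single k] <;> simp +contextual [Fin.ext_iff, eq_comm]

lemma cycMul_cycMonomial_right (n : ℕ) (σ : L ≃ₐ[F] L) (a : L) (x : Fin n → L) {j : ℕ}
    (hj : j < n) (y : L) (k : Fin n) :
    cycMul n σ a x (cycMonomial n j y) k = ∑ i : Fin n,
      if (i : ℕ) + j = k then x i * (σ ^ (i : ℕ)) y
      else if (i : ℕ) + j = k + n then x i * (σ ^ (i : ℕ)) y * a else 0 := by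
  refine Finset.sum_congr rfl fun i _ => ?_
  rw [Finset.sum_eq_single ⟨j, hj⟩]
  · simp [cycMonomial]
  · intro b _ hb
    have : (b : ℕ) ≠ j := fun h => hb (Fin.ext h)
    simp [cycMonomial, this]
  · simp

lemma cycMul_cycMonomial_right_of_add_eq (n : ℕ) (σ : L ≃ₐ[F] L) (a : L) (x : Fin n → L) {j : ℕ}
    (hj : j < n) (y : L) (k i : Fin n) (h : (i : ℕ) + j = k) :
    cycMul n σ a x (cycMonomial n j y) k = x i * (σ ^ (i : ℕ)) y := by
  rw [cycMul_cycMonomial_right n σ a x hj, Finset.sum_eq_single i]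
  · simp [h]
  · intro b _ hb
    have : (b : ℕ) ≠ i := fun h => hb (Fin.ext h)
    rw [if_neg (by lia), if_neg (by lia)]
  · simp

lemma cycMul_cycMonomial_right_of_add_eq_add (n : ℕ) (σ : L ≃ₐ[F] L) (a : L) (x : Fin n → L)
    {j : ℕ} (hj : j < n) (y : L) (k i : Fin n) (h : (i : ℕ) + j = k + n) :
    cycMul n σ a x (cycMonomial n j y) k = x i * (σ ^ (i : ℕ)) y * a := by
  rw [cycMul_cycMonomial_right n σ a x hj, Finset.sum_eq_single i]
  · rw [if_neg (by lia), if_pos h]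
  · intro b _ hb
    have : (b : ℕ) ≠ i := fun h => hb (Fin.ext h)
    rw [if_neg (by lia), if_neg (by lia)]
  · simp

lemma cycMul_cycMonomial_zero_right (n : ℕ) (σ : L ≃ₐ[F] L) (a : L) (x : Fin n → L) (y : L)
    (k : Fin n) : cycMul n σ a x (cycMonomial n 0 y) k = x k * (σ ^ (k : ℕ)) y :=
  cycMul_cycMonomial_right_of_add_eq n σ a x k.pos y k k rfl

lemma cycMul_cycMonomial_zero_left (n : ℕ) (σ : L ≃ₐ[F] L) (a l : L) (x : Fin n → L) :
    cycMul n σ a (cycMonomial n 0 l) x = l • x := by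
  ext k
  have hn := k.pos
  simp only [cycMul, Pi.smul_apply, smul_eq_mul]
  rw [Finset.sum_eq_single ⟨0, hn⟩, Finset.sum_eq_single k]
  · simp [cycMonomial]
  · intro b _ hb
    have : (b : ℕ) ≠ k := fun h => hb (Fin.ext h)
    rw [if_neg (by simpa using this), if_neg (by simp; lia)]
  · simp
  · intro b _ hb
    have : (b : ℕ) ≠ 0 := fun h => hb (Fin.ext h)
    simp [cycMonomial, this]
  · simp

lemma cycMul_smul_left (n : ℕ) (σ : L ≃ₐ[F] L) (a l : L) (x y : Fin n → L) :
    cycMul n σ a (l • x) y = l • cycMul n σ a x y := by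
  ext k
  simp only [cycMul, Pi.smul_apply, smul_eq_mul, Finset.mul_sum]
  refine Finset.sum_congr rfl fun i _ => Finset.sum_congr rfl fun j _ => ?_
  split_ifs <;> ring

lemma cycMul_cycMonomial_cycMonomial (n : ℕ) (σ : L ≃ₐ[F] L) (a : L) {i j : ℕ}
    (h : i + j < n) (x y : L) :
    cycMul n σ a (cycMonomial n i x) (cycMonomial n j y) =
      cycMonomial n (i + j) (x * (σ ^ i) y) := by
  ext k
  rw [cycMul_cycMonomial_right n σ a _ (by lia), Finset.sum_eq_single ⟨i, by lia⟩]
  · simp only [cycMonomial, if_true]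
    rw [if_neg (c := i + j = k + n) (by lia)]
    simp only [eq_comm]
  · intro b _ hb
    have : (b : ℕ) ≠ i := fun h => hb (Fin.ext h)
    simp [cycMonomial, this]
  · simp

lemma cycMul_cycMonomial_cycMonomial_of_add_eq (n : ℕ) (σ : L ≃ₐ[F] L) (a : L) {i j : ℕ}
    (hi : i < n) (hj : j < n) (h : i + j = n) (x y : L) :
    cycMul n σ a (cycMonomial n i x) (cycMonomial n j y) =
      cycMonomial n 0 (x * (σ ^ i) y * a) := by
  ext k
  rw [cycMul_cycMonomial_right n σ a _ hj, Finset.sum_eq_single ⟨i, hi⟩]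
  · simp only [cycMonomial, if_true]
    rw [if_neg (c := i + j = k) (by lia)]
    simp [h]
  · intro b _ hb
    have : (b : ℕ) ≠ i := fun h => hb (Fin.ext h)
    simp [cycMonomial, this]
  · simp

/-- Elements of the left nucleus have degree zero. -/
lemma eq_cycMonomial_of_left_nucleus {n : ℕ} (hn : 2 ≤ n) (σ : L ≃ₐ[F] L) {a : L}
    (ha : ∀ i, 0 < i → i < n → (σ ^ i) a ≠ a) (w : Fin n → L)
    (hw : ∀ x y, cycMul n σ a w (cycMul n σ a x y) = cycMul n σ a (cycMul n σ a w x) y) :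
    w = cycMonomial n 0 (w ⟨0, by lia⟩) := by
  ext k
  rcases Nat.eq_zero_or_pos k with hk | hk
  · simp only [cycMonomial, hk, if_true]
    congr 1
    exact Fin.ext hk
  · simp only [cycMonomial, hk.ne', if_false]
    have h := congrFun (hw (cycMonomial n (n - 1) 1) (cycMonomial n 1 1)) k
    rw [cycMul_cycMonomial_cycMonomial_of_add_eq n σ a (by lia) (by lia) (by lia),
      cycMul_cycMonomial_zero_right,
      cycMul_cycMonomial_right_of_add_eq n σ a _ (by lia) _ k ⟨k - 1, by lia⟩ (by simp; lia),
      cycMul_cycMonomial_right_of_add_eq_add n σ a _ (by lia) _ ⟨k - 1, by lia⟩ k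
        (by simp; lia)] at h
    simp only [map_one, mul_one, one_mul] at h
    by_contra hwk
    exact ha k hk k.2 (mul_left_cancel₀ hwk h)

lemma cycOne_eq (n : ℕ) : cycOne L n = cycMonomial n 0 1 := rfl

/-- An algebra automorphism preserves the degree-zero part and restricts to it. -/
lemma exists_algEquiv_of_mem_ntAut [FiniteDimensional F L] {n : ℕ} (hn : 2 ≤ n) (σ : L ≃ₐ[F] L)
    {a : L} (ha : ∀ i, 0 < i → i < n → (σ ^ i) a ≠ a) (φ : (Fin n → L) ≃ₗ[F] (Fin n → L))
    (hφ : φ ∈ ntAut F (Fin n → L) (cycMul n σ a) (cycOne L n)) :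
    ∃ τ : L ≃ₐ[F] L, ∀ l, φ (cycMonomial n 0 l) = cycMonomial n 0 (τ l) := by
  obtain ⟨hmul, hone⟩ := hφ
  have h0 : ∀ l, φ (cycMonomial n 0 l) =
      cycMonomial n 0 (φ (cycMonomial n 0 l) ⟨0, by lia⟩) := by
    intro l
    refine eq_cycMonomial_of_left_nucleus hn σ ha _ fun x y => ?_
    obtain ⟨x, rfl⟩ := φ.surjective x
    obtain ⟨y, rfl⟩ := φ.surjective y
    simp only [← hmul, cycMul_cycMonomial_zero_left, cycMul_smul_left]
  have inj : ∀ x y : L, cycMonomial n 0 x = cycMonomial n 0 y → x = y := fun x y h => by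
    simpa [cycMonomial] using congrFun h ⟨0, by lia⟩
  let τ : L →ₐ[F] L := AlgHom.ofLinearMap
    { toFun := fun l => φ (cycMonomial n 0 l) ⟨0, by lia⟩
      map_add' := fun x y => by simp [cycMonomial_add]
      map_smul' := fun f x => by simp [cycMonomial_smul] }
    (inj _ _ ((h0 1).symm.trans (by rw [← cycOne_eq, hone])))
    (fun x y => inj _ _ <| (h0 (x * y)).symm.trans <| by
      have := hmul (cycMonomial n 0 x) (cycMonomial n 0 y)
      rw [h0 x, h0 y, cycMul_cycMonomial_cycMonomial n σ a (by lia),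
        cycMul_cycMonomial_cycMonomial n σ a (by lia)] at this
      simpa using this)
  refine ⟨AlgEquiv.ofBijective τ (Algebra.IsAlgebraic.algHom_bijective τ), fun l => h0 l⟩

/-- Every automorphism is of the form `∑ xᵢ zⁱ ↦ ∑ τ(xᵢ) (k z)ⁱ`. -/
lemma exists_eq_of_mem_ntAut [FiniteDimensional F L] {n : ℕ} (hn : 2 ≤ n) (σ : L ≃ₐ[F] L)
    (hσ : orderOf σ = n) (hcomm : ∀ τ : L ≃ₐ[F] L, Commute σ τ)
    {a : L} (ha : ∀ i, 0 < i → i < n → (σ ^ i) a ≠ a) (φ : (Fin n → L) ≃ₗ[F] (Fin n → L))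
    (hφ : φ ∈ ntAut F (Fin n → L) (cycMul n σ a) (cycOne L n)) :
    ∃ (τ : L ≃ₐ[F] L) (k : Lˣ), τ a = partialNorm σ k n * a ∧
      ∀ x i, φ x i = τ (x i) * partialNorm σ k i := by
  obtain ⟨τ, hτ⟩ := exists_algEquiv_of_mem_ntAut hn σ ha φ hφ
  obtain ⟨hmul, -⟩ := hφ
  set k : L := φ (cycMonomial n 1 1) ⟨1, by lia⟩ with hk
  have ha0 : a ≠ 0 := fun h => ha 1 one_pos (by lia) (by simp [h])
  have hz : φ (cycMonomial n 1 1) = cycMonomial n 1 k := by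
    ext i
    by_cases hi : (i : ℕ) = 1
    · simp only [cycMonomial, hi, if_true]
      exact congrArg _ (Fin.ext hi)
    · simp only [cycMonomial, hi, if_false]
      by_contra hne
      refine hi ?_
      have key : σ ^ (i : ℕ) = σ ^ 1 := by
        ext l
        obtain ⟨l, rfl⟩ := τ.surjective l
        have h1 := congrFun (hmul (cycMonomial n 1 1) (cycMonomial n 0 l)) i
        have h2 := congrFun (hmul (cycMonomial n 0 (σ l)) (cycMonomial n 1 1)) i
        rw [cycMul_cycMonomial_cycMonomial n σ a (by lia)] at h1 h2
        rw [hτ, cycMul_cycMonomial_zero_right] at h1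
        rw [hτ, cycMul_cycMonomial_zero_left] at h2
        simp only [zero_add, add_zero, pow_one, one_mul, pow_zero, map_one, mul_one,
          Pi.smul_apply, smul_eq_mul] at h1 h2
        rw [h1, mul_comm] at h2
        rw [mul_right_cancel₀ hne h2]
        exact (DFunLike.congr_fun (hcomm τ).eq l).symm
      have hmod := pow_inj_mod.1 key
      rwa [hσ, Nat.mod_eq_of_lt i.2, Nat.mod_eq_of_lt (by lia)] at hmod
  have hpow : ∀ i, i < n → φ (cycMonomial n i 1) = cycMonomial n i (partialNorm σ k i) := by
    intro i
    induction i with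
    | zero => intro _; simp [hτ]
    | succ i ih =>
      intro hi
      have := hmul (cycMonomial n 1 1) (cycMonomial n i 1)
      rw [cycMul_cycMonomial_cycMonomial n σ a (by lia), hz, ih (by lia),
        cycMul_cycMonomial_cycMonomial n σ a (by lia)] at this
      rw [add_comm i 1, partialNorm_add]
      simpa using this
  have hnorm : τ a = partialNorm σ k n * a := by
    have := hmul (cycMonomial n 1 1) (cycMonomial n (n - 1) 1)
    rw [cycMul_cycMonomial_cycMonomial_of_add_eq n σ a (by lia) (by lia) (by lia), hz,
      hpow _ (by lia), hτ,
      cycMul_cycMonomial_cycMonomial_of_add_eq n σ a (by lia) (by lia) (by lia)] at this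
    have := congrFun this ⟨0, by lia⟩
    have hn1 : partialNorm σ k n = k * (σ ^ 1) (partialNorm σ k (n - 1)) := by
      rw [show n = 1 + (n - 1) by lia, partialNorm_add, partialNorm_one, Nat.add_sub_cancel_left]
    simpa [cycMonomial, hn1] using this
  have hk0 : k ≠ 0 := by
    intro h
    rw [show n = 1 + (n - 1) by lia, partialNorm_add, partialNorm_one, h] at hnorm
    simp [ha0] at hnorm
  refine ⟨τ, Units.mk0 k hk0, hnorm, fun x i => ?_⟩
  have hterm : ∀ j : Fin n, φ (cycMonomial n j (x j)) =
      cycMonomial n j (τ (x j) * partialNorm σ k j) := by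
    intro j
    have := hmul (cycMonomial n 0 (x j)) (cycMonomial n j 1)
    rw [cycMul_cycMonomial_cycMonomial n σ a (by lia), hτ, hpow _ j.2,
      cycMul_cycMonomial_cycMonomial n σ a (by lia)] at this
    simpa using this
  conv_lhs => rw [← sum_cycMonomial n x, map_sum]
  simp only [hterm]
  exact congrFun (sum_cycMonomial n fun j => τ (x j) * partialNorm σ k j) i

/-- The linear automorphism `∑ xᵢ zⁱ ↦ ∑ τ(xᵢ) (k z)ⁱ`. -/
def cycLinearEquiv (n : ℕ) (σ τ : L ≃ₐ[F] L) (k : Lˣ) : (Fin n → L) ≃ₗ[F] (Fin n → L) where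
  toFun x i := τ (x i) * partialNorm σ k i
  invFun x i := τ.symm (x i / partialNorm σ k i)
  map_add' x y := by ext i; simp [add_mul]
  map_smul' f x := by ext i; simp
  left_inv x := by ext i; simp [partialNorm_ne_zero σ k.ne_zero]
  right_inv x := by ext i; simp [partialNorm_ne_zero σ k.ne_zero]

@[simp] lemma cycLinearEquiv_apply (n : ℕ) (σ τ : L ≃ₐ[F] L) (k : Lˣ) (x : Fin n → L)
    (i : Fin n) : cycLinearEquiv n σ τ k x i = τ (x i) * partialNorm σ k i := rfl

lemma cycLinearEquiv_injective {n : ℕ} (hn : 2 ≤ n) (σ : L ≃ₐ[F] L) {τ τ' : L ≃ₐ[F] L}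
    {k k' : Lˣ} (h : cycLinearEquiv n σ τ k = cycLinearEquiv n σ τ' k') : τ = τ' ∧ k = k' := by
  constructor
  · ext l
    simpa using congrFun (DFunLike.congr_fun h fun _ => l) ⟨0, by lia⟩
  · ext
    simpa using congrFun (DFunLike.congr_fun h fun _ => 1) ⟨1, by lia⟩

lemma cycLinearEquiv_mem_ntAut {n : ℕ} {σ : L ≃ₐ[F] L}
    (hσ : σ ^ n = 1) (hcomm : ∀ τ : L ≃ₐ[F] L, Commute σ τ) {a : L} {τ : L ≃ₐ[F] L} {k : Lˣ}
    (h : τ a = partialNorm σ k n * a) :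
    cycLinearEquiv n σ τ k ∈ ntAut F (Fin n → L) (cycMul n σ a) (cycOne L n) := by
  have hc : ∀ (i : ℕ) (y : L), τ ((σ ^ i) y) = (σ ^ i) (τ y) := fun i y =>
    (DFunLike.congr_fun ((hcomm τ).pow_left i).eq y).symm
  refine ⟨fun x y => ?_, ?_⟩
  · ext m
    simp only [cycLinearEquiv_apply, cycMul, map_sum, Finset.sum_mul]
    refine Finset.sum_congr rfl fun i _ => Finset.sum_congr rfl fun j _ => ?_
    split_ifs with h1 h2
    · rw [← h1, partialNorm_add, map_mul, map_mul, hc]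
      ring
    · have : partialNorm σ (k : L) i * (σ ^ (i : ℕ)) (partialNorm σ k j) =
          partialNorm σ k n * partialNorm σ k m := by
        rw [← partialNorm_add, h2, add_comm, partialNorm_add, hσ, AlgEquiv.one_apply]
      rw [map_mul, map_mul, map_mul, h, hc]
      linear_combination (-τ (x i) * (σ ^ (i : ℕ)) (τ (y j)) * a) * this
    · simp
  · ext m
    by_cases hm : (m : ℕ) = 0 <;> simp [cycOne, hm]

end CyclicAlgebra

section Norm

variable {F L : Type*} [Field F] [Field L] [Algebra F L]

lemma partialNorm_eq_algebraMap_norm [FiniteDimensional F L] [IsGalois F L] {n : ℕ}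
    {σ : L ≃ₐ[F] L} (hn : orderOf σ = n) (hσ : ∀ τ : L ≃ₐ[F] L, τ ∈ Subgroup.zpowers σ) (k : L) :
    partialNorm σ k n = algebraMap F L (Algebra.norm F k) := by
  classical
  rw [Algebra.norm_eq_prod_automorphisms, ← IsCyclic.image_range_orderOf hσ, Finset.prod_image,
    hn, partialNorm]
  intro i hi j hj h
  exact pow_injOn_Iio_orderOf (by simpa using hi) (by simpa using hj) h

lemma apply_eq_partialNorm_mul_iff [FiniteDimensional F L] [IsGalois F L] {n : ℕ}
    {σ : L ≃ₐ[F] L} (hn : orderOf σ = n) (hσ : ∀ τ : L ≃ₐ[F] L, τ ∈ Subgroup.zpowers σ)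
    {a : L} (ha : a ≠ 0) {τ : L ≃ₐ[F] L} {f : Fˣ} (hf : τ a = algebraMap F L f * a) (k : Lˣ) :
    τ a = partialNorm σ k n * a ↔ Units.map (Algebra.norm F (S := L)) k = f := by
  rw [partialNorm_eq_algebraMap_norm hn hσ, hf, mul_left_inj' ha,
    (algebraMap F L).injective.eq_iff, Units.ext_iff, eq_comm]
  rfl

lemma card_ker_unitsMap_norm [Finite L] [Finite F] :
    Nat.card (Units.map (Algebra.norm F (S := L))).ker =
      (Nat.card L - 1) / (Nat.card F - 1) := by
  have h := (Units.map (Algebra.norm F (S := L))).ker.card_mul_index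
  rw [Subgroup.index_ker,
    MonoidHom.range_eq_top.2 (FiniteField.unitsMap_norm_surjective F L), Subgroup.card_top,
    Nat.card_units, Nat.card_units] at h
  rw [← h, Nat.mul_div_cancel]
  have := Finite.one_lt_card (α := F)
  lia

lemma card_norm_fiber [Finite L] [Finite F] (f : Fˣ) :
    Nat.card {k : Lˣ // Units.map (Algebra.norm F (S := L)) k = f} =
      (Nat.card L - 1) / (Nat.card F - 1) := by
  rw [← card_ker_unitsMap_norm]
  obtain ⟨k₀, rfl⟩ := FiniteField.unitsMap_norm_surjective F L f
  refine Nat.card_congr ((Equiv.mulRight k₀⁻¹).subtypeEquiv fun k => ?_)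
  rw [Equiv.coe_mulRight, MonoidHom.mem_ker, map_mul, map_inv, mul_inv_eq_one]

lemma mem_range_algebraMap_of_pow_eq_one [Finite L] [Finite F] [IsGalois F L] {m : ℕ}
    (hm : m ∣ Nat.card F - 1) {x : L} (hx : x ^ m = 1) : x ∈ Set.range (algebraMap F L) := by
  have hq := Finite.one_lt_card (α := F)
  have hxq : x ^ Nat.card F = x := by
    obtain ⟨d, hd⟩ := hm
    rw [show Nat.card F = m * d + 1 by lia, pow_succ, pow_mul, hx, one_pow, one_mul]
  have : Fact (ringChar F).Prime := ⟨CharP.prime_ringChar F⟩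
  refine (IsGalois.mem_range_algebraMap_iff_fixed x).2 fun g => ?_
  obtain ⟨i, hi⟩ := FiniteField.exists_forall_apply_eq_pow F (ringChar F) L g
  rw [hi]
  clear hi
  induction i with
  | zero => simp
  | succ i ih => rw [pow_succ, pow_mul, ih, hxq]

lemma exists_apply_eq_algebraMap_mul [Finite L] [Finite F] [IsGalois F L] {r : ℕ}
    (hr : r ∣ Nat.card F - 1) {c : F} (hc : c ≠ 0) {T : L} (hT : T ^ r = algebraMap F L c)
    (τ : L ≃ₐ[F] L) : ∃ w : F, w ≠ 0 ∧ w ^ r = 1 ∧ τ T = algebraMap F L w * T := by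
  have hTr : T ^ r ≠ 0 := by simpa [hT] using hc
  have hr0 : r ≠ 0 := by
    rintro rfl
    have := Finite.one_lt_card (α := F)
    lia
  have hT0 : T ≠ 0 := fun h => hTr (by simp [h, hr0])
  have hw : (τ T / T) ^ r = 1 := by
    rw [div_pow, ← map_pow, hT, AlgEquiv.commutes, div_self (hT ▸ hTr)]
  obtain ⟨w, hw'⟩ := mem_range_algebraMap_of_pow_eq_one hr hw
  have hwr : w ^ r = 1 := (algebraMap F L).injective (by rw [map_pow, hw', hw, map_one])
  exact ⟨w, fun h => by simp [h, hr0] at hwr, hwr, by rw [hw', div_mul_cancel₀ _ hT0]⟩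

/-- An eigenvector of a nontrivial automorphism of a Kummer extension of prime degree is a
scalar multiple of a power of the Kummer generator. -/
lemma eq_algebraMap_mul_pow_of_apply_eq [Finite L] [Finite F] [IsGalois F L] {r : ℕ}
    (hr : r.Prime) (hrank : Module.finrank F L = r) (hdvd : r ∣ Nat.card F - 1) {c : F}
    (hc : c ≠ 0) {T : L} (hT : T ^ r = algebraMap F L c)
    (hadj : IntermediateField.adjoin F {T} = ⊤) {a : L} (ha : a ≠ 0) {τ : L ≃ₐ[F] L}
    (hτ : τ ≠ 1) {f : F} (h : τ a = algebraMap F L f * a) :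
    ∃ k : F, ∃ j < r, a = algebraMap F L k * T ^ j := by
  obtain ⟨w, hw0, hwr, hw⟩ := exists_apply_eq_algebraMap_mul hdvd hc hT τ
  have hT0 : T ≠ 0 := fun h => hc <| (algebraMap F L).injective <| by
    rw [← hT, h, zero_pow hr.ne_zero, map_zero]
  have : Fact r.Prime := ⟨hr⟩
  have hw1 : w ≠ 1 := by
    rintro rfl
    refine hτ (AlgEquiv.coe_toAlgHom_injective ?_)
    refine AlgHom.ext_of_adjoin_eq_top (IntermediateField.adjoin_eq_top_iff.1 hadj) ?_
    simpa [Set.EqOn] using hw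
  have hprim : IsPrimitiveRoot w r :=
    (orderOf_eq_prime hwr hw1) ▸ IsPrimitiveRoot.orderOf w
  have hfr : f ^ r = 1 := by
    have h1 := congrArg (Algebra.norm F) h
    rw [map_mul, Algebra.norm_algebraMap, hrank, Algebra.norm_eq_of_algEquiv] at h1
    exact mul_right_cancel₀ (Algebra.norm_ne_zero_iff.2 ha) (by rw [← h1, one_mul])
  obtain ⟨j, hj, rfl⟩ := hprim.eq_pow_of_pow_eq_one hfr
  have hfix : τ (a / T ^ j) = a / T ^ j := by
    have : algebraMap F L w ≠ 0 := by simpa using hw0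
    rw [map_div₀, map_pow, h, hw, map_pow, mul_pow]
    field_simp
  have hcard : Nat.card (L ≃ₐ[F] L) = r := by rw [IsGalois.card_aut_eq_finrank, hrank]
  obtain ⟨k, hk⟩ := (IsGalois.mem_range_algebraMap_iff_fixed (F := F) (a / T ^ j)).2 fun g => by
    have hg : g ∈ MulAction.stabilizer (L ≃ₐ[F] L) (a / T ^ j) :=
      (Subgroup.zpowers_le.2 (show τ ∈ _ from hfix)) (mem_zpowers_of_prime_card hcard hτ)
    exact hg
  exact ⟨k, j, hj, by rw [hk, div_mul_cancel₀ _ (pow_ne_zero _ hT0)]⟩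

end Norm

section Automorphisms

variable {F L : Type*} [Field F] [Field L] [Algebra F L]

/-- The automorphisms of the nonassociative cyclic algebra are parametrized by the pairs `(τ, k)`
with `τ(a) = N(k) a`. -/
def cycAutEquiv [FiniteDimensional F L] {n : ℕ} (hn : 2 ≤ n) {σ : L ≃ₐ[F] L}
    (hσ : orderOf σ = n) (hcomm : ∀ τ : L ≃ₐ[F] L, Commute σ τ)
    {a : L} (ha : ∀ i, 0 < i → i < n → (σ ^ i) a ≠ a) :
    {p : (L ≃ₐ[F] L) × Lˣ // p.1 a = partialNorm σ p.2 n * a} ≃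
      ntAut F (Fin n → L) (cycMul n σ a) (cycOne L n) :=
  Equiv.ofBijective
    (fun p => ⟨cycLinearEquiv n σ p.1.1 p.1.2,
      cycLinearEquiv_mem_ntAut (hσ ▸ pow_orderOf_eq_one σ) hcomm p.2⟩) <| by
    constructor
    · intro p p' h
      obtain ⟨h1, h2⟩ := cycLinearEquiv_injective hn σ (congrArg Subtype.val h)
      exact Subtype.ext (Prod.ext h1 h2)
    · rintro ⟨φ, hφ⟩
      obtain ⟨τ, k, h, hφ'⟩ := exists_eq_of_mem_ntAut hn σ hσ hcomm ha φ hφ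
      refine ⟨⟨(τ, k), h⟩, Subtype.ext (LinearEquiv.ext fun x => funext fun i => ?_)⟩
      exact (hφ' x i).symm

@[simp] lemma coe_cycAutEquiv [FiniteDimensional F L] {n : ℕ} (hn : 2 ≤ n) {σ : L ≃ₐ[F] L}
    (hσ : orderOf σ = n) (hcomm : ∀ τ : L ≃ₐ[F] L, Commute σ τ)
    {a : L} (ha : ∀ i, 0 < i → i < n → (σ ^ i) a ≠ a)
    (p : {p : (L ≃ₐ[F] L) × Lˣ // p.1 a = partialNorm σ p.2 n * a}) :
    (cycAutEquiv hn hσ hcomm ha p : (Fin n → L) ≃ₗ[F] (Fin n → L)) =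
      cycLinearEquiv n σ p.1.1 p.1.2 := rfl

/-- If only the identity of `L` extends to the algebra, its automorphism group is the group of
elements of norm one. -/
lemma nonempty_ker_norm_mulEquiv_ntAut [FiniteDimensional F L] [IsGalois F L] {n : ℕ}
    (hn : 2 ≤ n) {σ : L ≃ₐ[F] L} (hσ : orderOf σ = n)
    (hgen : ∀ τ : L ≃ₐ[F] L, τ ∈ Subgroup.zpowers σ) (hcomm : ∀ τ : L ≃ₐ[F] L, Commute σ τ)
    {a : L} (ha : ∀ i, 0 < i → i < n → (σ ^ i) a ≠ a)
    (hone : ∀ (τ : L ≃ₐ[F] L) (f : F), τ a = algebraMap F L f * a → τ = 1) :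
    Nonempty ((Units.map (Algebra.norm F (S := L))).ker ≃*
      ntAut F (Fin n → L) (cycMul n σ a) (cycOne L n)) := by
  have ha0 : a ≠ 0 := fun h => ha 1 one_pos (by lia) (by simp [h])
  have hker : ∀ k : Lˣ, k ∈ (Units.map (Algebra.norm F (S := L))).ker ↔
      (1 : L ≃ₐ[F] L) a = partialNorm σ k n * a := fun k => by
    rw [apply_eq_partialNorm_mul_iff hσ hgen ha0 (f := 1) (by simp), MonoidHom.mem_ker]
  let e : (Units.map (Algebra.norm F (S := L))).ker →*
      ntAut F (Fin n → L) (cycMul n σ a) (cycOne L n) :=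
    MonoidHom.mk' (fun k => cycAutEquiv hn hσ hcomm ha ⟨(1, k), (hker k).1 k.2⟩) <| by
      intro k l
      ext x i
      simp [partialNorm_mul]
      ring
  refine ⟨MulEquiv.ofBijective e ⟨fun k l h => ?_, fun φ => ?_⟩⟩
  · have := congrArg (fun p => p.1.2) ((cycAutEquiv hn hσ hcomm ha).injective h)
    exact Subtype.ext this
  · obtain ⟨⟨⟨τ, k⟩, h⟩, rfl⟩ := (cycAutEquiv hn hσ hcomm ha).surjective φ
    obtain rfl : τ = 1 :=
      hone τ _ (by rw [h, partialNorm_eq_algebraMap_norm hσ hgen])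
    exact ⟨⟨k, (hker k).2 h⟩, rfl⟩

/-- If `a` is an eigenvector of all automorphisms, each of them extends in as many ways as there
are elements of norm one. -/
lemma card_ntAut_of_forall_apply_eq [Finite F] [Finite L] [IsGalois F L] {n : ℕ}
    (hn : 2 ≤ n) {σ : L ≃ₐ[F] L} (hσ : orderOf σ = n)
    (hgen : ∀ τ : L ≃ₐ[F] L, τ ∈ Subgroup.zpowers σ) (hcomm : ∀ τ : L ≃ₐ[F] L, Commute σ τ)
    {a : L} (ha : ∀ i, 0 < i → i < n → (σ ^ i) a ≠ a)
    (heig : ∀ τ : L ≃ₐ[F] L, ∃ f : Fˣ, τ a = algebraMap F L f * a) :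
    Nat.card (ntAut F (Fin n → L) (cycMul n σ a) (cycOne L n)) =
      n * ((Nat.card L - 1) / (Nat.card F - 1)) := by
  have ha0 : a ≠ 0 := fun h => ha 1 one_pos (by lia) (by simp [h])
  choose f hf using heig
  have hiff := fun τ => apply_eq_partialNorm_mul_iff hσ hgen ha0 (hf τ)
  let e : {p : (L ≃ₐ[F] L) × Lˣ // p.1 a = partialNorm σ p.2 n * a} ≃
      Σ τ : L ≃ₐ[F] L, {k : Lˣ // Units.map (Algebra.norm F (S := L)) k = f τ} :=
    { toFun := fun p => ⟨p.1.1, p.1.2, (hiff _ _).1 p.2⟩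
      invFun := fun p => ⟨(p.1, p.2.1), (hiff _ _).2 p.2.2⟩
      left_inv := fun _ => rfl
      right_inv := fun _ => rfl }
  rw [← Nat.card_congr (cycAutEquiv hn hσ hcomm ha), Nat.card_congr e, Nat.card_sigma]
  simp only [card_norm_fiber, Finset.sum_const, Finset.card_univ, smul_eq_mul]
  rw [← Nat.card_eq_fintype_card, ← orderOf_eq_card_of_forall_mem_zpowers hgen, hσ]

end Automorphisms

/-- let `F = 𝔽_q`, `r` prime with `r ∣ q - 1`, and `L = F[T]/(T^r - c)` of
degree `r` over `F`.  If `a ∈ L \ F` is not of the form `k T^j` (`k ∈ Fˣ`,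
`1 ≤ j ≤ r-1`), then `Aut((L/F,σ,a)) ≅ ℤ/sℤ` with `s = (q^r - 1)/(q - 1)`; if
`a = k T^j` for some such `k, j`, then `Aut((L/F,σ,a))` has order `r·(q^r - 1)/(q - 1)`. -/
theorem sandler_aut_kummer_case
    {F L : Type*} [Field F] [Fintype F] [Field L] [Algebra F L] [IsGalois F L]
    (q r : ℕ) (hq : Fintype.card F = q) (hr : r.Prime)
    (hrank : Module.finrank F L = r) (hdvd : r ∣ q - 1)
    (c : F) (hc : c ≠ 0) (T : L) (hT : T ^ r = algebraMap F L c)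
    (hadj : IntermediateField.adjoin F {T} = ⊤)
    (σ : L ≃ₐ[F] L) (hσ : ∀ τ : L ≃ₐ[F] L, τ ∈ Subgroup.zpowers σ)
    (a : L) (ha : a ∉ Set.range (algebraMap F L)) :
    ((¬ ∃ k : F, k ≠ 0 ∧ ∃ j : ℕ, 1 ≤ j ∧ j ≤ r - 1 ∧ a = algebraMap F L k * T ^ j) →
      Nonempty (↥(ntAut F (Fin r → L) (cycMul r σ a) (cycOne L r)) ≃*
        Multiplicative (ZMod ((q ^ r - 1) / (q - 1))))) ∧
    ((∃ k : F, k ≠ 0 ∧ ∃ j : ℕ, 1 ≤ j ∧ j ≤ r - 1 ∧ a = algebraMap F L k * T ^ j) →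
      Nat.card ↥(ntAut F (Fin r → L) (cycMul r σ a) (cycOne L r))
        = r * ((q ^ r - 1) / (q - 1))) := by
  subst hq
  have hcF : Nat.card F = Fintype.card F := Nat.card_eq_fintype_card
  rw [← hcF] at hdvd
  have hfd : FiniteDimensional F L := Module.finite_of_finrank_pos (hrank ▸ hr.pos)
  have hfin : Finite L := Module.finite_of_finite F
  have hcL : Nat.card L = Fintype.card F ^ r := by
    rw [Module.natCard_eq_pow_finrank (K := F), hrank, hcF]
  have hcard : Nat.card (L ≃ₐ[F] L) = r := by rw [IsGalois.card_aut_eq_finrank, hrank]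
  have hord : orderOf σ = r := (orderOf_eq_card_of_forall_mem_zpowers hσ).trans hcard
  have hcomm : ∀ τ : L ≃ₐ[F] L, Commute σ τ := by
    intro τ
    obtain ⟨m, rfl⟩ := Subgroup.mem_zpowers_iff.1 (hσ τ)
    exact Commute.self_zpow σ m
  have : Fact r.Prime := ⟨hr⟩
  have hfix : ∀ i, 0 < i → i < r → (σ ^ i) a ≠ a := by
    intro i hi hir h
    have hne : σ ^ i ≠ 1 := pow_ne_one_of_lt_orderOf hi.ne' (hord ▸ hir)
    refine ha ((IsGalois.mem_range_algebraMap_iff_fixed a).2 fun g => ?_)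
    have hg : g ∈ MulAction.stabilizer (L ≃ₐ[F] L) a :=
      (Subgroup.zpowers_le.2 (show σ ^ i ∈ _ from h)) (mem_zpowers_of_prime_card hcard hne)
    exact hg
  have ha0 : a ≠ 0 := fun h => ha ⟨0, by simp [h]⟩
  refine ⟨fun hnot => ?_, ?_⟩
  · obtain ⟨e⟩ := nonempty_ker_norm_mulEquiv_ntAut hr.two_le hord hσ hcomm hfix fun τ f h => by
      by_contra hτ
      obtain ⟨k, j, hj, hk⟩ :=
        eq_algebraMap_mul_pow_of_apply_eq hr hrank hdvd hc hT hadj ha0 hτ h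
      refine hnot ⟨k, fun h0 => ha0 (by simp [hk, h0]), j, ?_, by lia, hk⟩
      refine Nat.one_le_iff_ne_zero.2 fun h0 => ha ⟨k, by simp [hk, h0]⟩
    rw [← hcL, ← hcF, ← card_ker_unitsMap_norm]
    exact ⟨e.symm.trans (zmodCyclicMulEquiv inferInstance).symm⟩
  · rintro ⟨k, -, j, -, -, rfl⟩
    rw [← hcL, ← hcF]
    refine card_ntAut_of_forall_apply_eq hr.two_le hord hσ hcomm hfix fun τ => ?_
    obtain ⟨w, hw0, -, hw⟩ := exists_apply_eq_algebraMap_mul hdvd hc hT τ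
    refine ⟨Units.mk0 w hw0 ^ j, ?_⟩
    rw [map_mul, AlgEquiv.commutes, map_pow, hw]
    simp only [Units.val_pow_eq_pow_val, Units.val_mk0, map_pow]
    ring
end
end
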